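/- For all a ∈ ℕ, all k ∈ ℕ and all tuples m = (m₁,…,m_k) of natural numbers, there is at most one n ∈ ℕ such that ⟨a,m₁,…,m_k,n⟩ ∈ Comp: if ⟨a,m,n⟩ ∈ Comp and ⟨a,m,n′⟩ ∈ Comp then n = n′. -/

import Mathlib

/-- The tuple coding `⟨m₁,…,m_k⟩ := p₁^{m₁+1} ⋯ p_k^{m_k+1}` (`p_i` the `i`-th prime),
with `⟨⟩ = 1`. -/
noncomputable def code (l : List ℕ) : ℕ :=
  ∏ i ∈ Finset.range l.length, (Nat.nth Nat.Prime i) ^ (l.getD i 0 + 1)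

/-- `CompClosed Sb0 X` says that the set `X ⊆ ℕ` is closed under the clauses of
Definition 4.1 (recursion in the type-2 functional `E`), relative to a fixed
S-m-n substitution function `Sb0`. -/
def CompClosed (Sb0 : ℕ → ℕ → ℕ) (X : Set ℕ) : Prop :=
  (∀ (k n : ℕ) (m : List ℕ), m.length = k →
      code (code [0, k, 0, n] :: m ++ [n]) ∈ X) ∧
  (∀ (k i : ℕ) (m : List ℕ), m.length = k → i < k →
      code (code [0, k, 1, i] :: m ++ [m.getD i 0]) ∈ X) ∧
  (∀ (k i : ℕ) (m : List ℕ), m.length = k → i < k →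
      code (code [0, k, 2, i] :: m ++ [m.getD i 0 + 1]) ∈ X) ∧
  (∀ (k p q r s : ℕ) (m : List ℕ), m.length = k → r = s →
      code (code [0, k + 3, 4] :: p :: q :: r :: s :: m ++ [p]) ∈ X) ∧
  (∀ (k p q r s : ℕ) (m : List ℕ), m.length = k → r ≠ s →
      code (code [0, k + 3, 4] :: p :: q :: r :: s :: m ++ [q]) ∈ X) ∧
  (∀ (k p q : ℕ) (m : List ℕ), m.length = k →
      code (code [0, k + 2, 5] :: p :: q :: m ++ [Sb0 p q]) ∈ X) ∧
  (∀ (k k' b n : ℕ) (m c q : List ℕ), m.length = k → c.length = k' → q.length = k' →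
      (∀ i < k', code (c.getD i 0 :: m ++ [q.getD i 0]) ∈ X) →
      code (b :: q ++ [n]) ∈ X →
      code (code ([1, k, b] ++ c) :: m ++ [n]) ∈ X) ∧
  (∀ (k b n : ℕ) (m : List ℕ), m.length = k →
      code (b :: m ++ [n]) ∈ X →
      code (code [2, k + 1] :: b :: m ++ [n]) ∈ X) ∧
  (∀ (k b : ℕ) (m : List ℕ), m.length = k →
      (∀ p : ℕ, ∃ kp : ℕ, 0 < kp ∧ code (b :: p :: m ++ [kp]) ∈ X) →
      code (code [3, k, b] :: m ++ [0]) ∈ X) ∧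
  (∀ (k b p : ℕ) (m : List ℕ), m.length = k →
      code (b :: p :: m ++ [0]) ∈ X →
      (∀ i < p, ∃ ki : ℕ, 0 < ki ∧ code (b :: i :: m ++ [ki]) ∈ X) →
      code (code [3, k, b] :: m ++ [p + 1]) ∈ X)

/-- `Comp Sb0` is the smallest set closed under the clauses of Definition 4.1. -/
def Comp (Sb0 : ℕ → ℕ → ℕ) : Set ℕ :=
  {u : ℕ | ∀ X : Set ℕ, CompClosed Sb0 X → u ∈ X}

theorem code_fact (l : List ℕ) (i : ℕ) :
    (code l).factorization (Nat.nth Nat.Prime i) = if i < l.length then l.getD i 0 + 1 else 0 := by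
  have hp : ∀ j, (Nat.nth Nat.Prime j).Prime := fun j => Nat.prime_nth_prime j
  have hinj : Function.Injective (Nat.nth Nat.Prime) :=
    Nat.nth_injective Nat.infinite_setOfPred_prime
  unfold code
  rw [Nat.factorization_prod (fun j _ => pow_ne_zero _ (hp j).ne_zero)]
  rw [Finset.sum_apply']
  have : ∀ j ∈ Finset.range l.length,
      ((Nat.nth Nat.Prime j) ^ (l.getD j 0 + 1)).factorization (Nat.nth Nat.Prime i)
        = if i = j then l.getD j 0 + 1 else 0 := by
    intro j _
    rw [(hp j).factorization_pow, Finsupp.single_apply]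
    simp only [hinj.eq_iff, eq_comm]
  rw [Finset.sum_congr rfl this, Finset.sum_ite_eq]
  simp

theorem code_inj {l l' : List ℕ} (h : code l = code l') : l = l' := by
  have key : ∀ i, (if i < l.length then l.getD i 0 + 1 else 0)
      = if i < l'.length then l'.getD i 0 + 1 else 0 := by
    intro i
    rw [← code_fact, ← code_fact, h]
  have hlen : l.length = l'.length := by
    rcases lt_trichotomy l.length l'.length with h1 | h1 | h1
    · have := key l.length
      simp [h1] at this
    · exact h1
    · have := key l'.length
      simp [h1] at this
  apply List.ext_getElem hlen
  intro i h1 h2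
  have := key i
  simpa [h1, h2] using this

/-- Decoded version of `Comp`. -/
inductive CompD (Sb0 : ℕ → ℕ → ℕ) : ℕ → List ℕ → ℕ → Prop
  | c0 (n : ℕ) (m : List ℕ) : CompD Sb0 (code [0, m.length, 0, n]) m n
  | c1 (i : ℕ) (m : List ℕ) : CompD Sb0 (code [0, m.length, 1, i]) m (m.getD i 0)
  | c2 (i : ℕ) (m : List ℕ) : CompD Sb0 (code [0, m.length, 2, i]) m (m.getD i 0 + 1)
  | c4 (p q r s : ℕ) (m : List ℕ) :
      CompD Sb0 (code [0, m.length + 3, 4]) (p :: q :: r :: s :: m) (if r = s then p else q)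
  | c5 (p q : ℕ) (m : List ℕ) :
      CompD Sb0 (code [0, m.length + 2, 5]) (p :: q :: m) (Sb0 p q)
  | comp (b n : ℕ) (m c q : List ℕ) (hq : q.length = c.length)
      (h1 : ∀ i < c.length, CompD Sb0 (c.getD i 0) m (q.getD i 0))
      (h2 : CompD Sb0 b q n) : CompD Sb0 (code ([1, m.length, b] ++ c)) m n
  | univ (b n : ℕ) (m : List ℕ) (h : CompD Sb0 b m n) :
      CompD Sb0 (code [2, m.length + 1]) (b :: m) n
  | e0 (b : ℕ) (m : List ℕ) (f : ℕ → ℕ) (hf : ∀ p, 0 < f p)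
      (h : ∀ p, CompD Sb0 b (p :: m) (f p)) : CompD Sb0 (code [3, m.length, b]) m 0
  | e1 (b p : ℕ) (m : List ℕ) (f : ℕ → ℕ) (hf : ∀ i < p, 0 < f i)
      (h0 : CompD Sb0 b (p :: m) 0)
      (h : ∀ i < p, CompD Sb0 b (i :: m) (f i)) : CompD Sb0 (code [3, m.length, b]) m (p + 1)

theorem CompD.of_code {Sb0 : ℕ → ℕ → ℕ} {a : ℕ} {m : List ℕ} {n : ℕ}
    (h : code (a :: m ++ [n]) ∈ Comp Sb0) : CompD Sb0 a m n := by
  let X : Set ℕ := {u | ∃ a m n, u = code (a :: m ++ [n]) ∧ CompD Sb0 a m n}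
  have hX : ∀ a m n, code (a :: m ++ [n]) ∈ X ↔ CompD Sb0 a m n := by
    intro a m n
    constructor
    · rintro ⟨a', m', n', he, hc⟩
      have := code_inj he
      simp only [List.cons_append, List.cons.injEq] at this
      obtain ⟨rfl, h2⟩ := this
      obtain ⟨rfl, h3⟩ := List.append_inj' h2 rfl
      simp at h3
      subst h3
      exact hc
    · intro hc
      exact ⟨a, m, n, rfl, hc⟩
  rw [← hX]
  apply h X
  refine ⟨?_, ?_, ?_, ?_, ?_, ?_, ?_, ?_, ?_, ?_⟩
  · rintro k n m rfl
    exact (hX _ _ _).2 (.c0 n m)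
  · rintro k i m rfl _
    exact (hX _ _ _).2 (.c1 i m)
  · rintro k i m rfl _
    exact (hX _ _ _).2 (.c2 i m)
  · rintro k p q r s m rfl hrs
    refine (hX _ (p :: q :: r :: s :: m) _).2 ?_
    simpa [hrs] using CompD.c4 (Sb0 := Sb0) p q r s m
  · rintro k p q r s m rfl hrs
    refine (hX _ (p :: q :: r :: s :: m) _).2 ?_
    simpa [hrs] using CompD.c4 (Sb0 := Sb0) p q r s m
  · rintro k p q m rfl
    exact (hX _ (p :: q :: m) _).2 (.c5 p q m)
  · rintro k k' b n m c q rfl rfl hq h1 h2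
    exact (hX _ _ _).2 (.comp b n m c q hq (fun i hi => (hX _ _ _).1 (h1 i hi)) ((hX _ _ _).1 h2))
  · rintro k b n m rfl h
    exact (hX _ (b :: m) _).2 (.univ b n m ((hX _ _ _).1 h))
  · rintro k b m rfl h
    choose f hf h using h
    exact (hX _ _ _).2 (.e0 b m f hf (fun p => (hX _ (p :: m) _).1 (h p)))
  · rintro k b p m rfl h0 h
    choose! f hf using h
    exact (hX _ _ _).2 (.e1 b p m f (fun i hi => (hf i hi).1) ((hX _ (p :: m) _).1 h0)
      (fun i hi => (hX _ (i :: m) _).1 (hf i hi).2))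

theorem CompD.det {Sb0 : ℕ → ℕ → ℕ} {a : ℕ} {m : List ℕ} {n : ℕ}
    (h : CompD Sb0 a m n) : ∀ n', CompD Sb0 a m n' → n = n' := by
  induction h with
  | c0 n m =>
    intro n' h'
    generalize ha : code _ = a at h'
    cases h' <;> have := code_inj ha <;> simp_all
  | c1 i m =>
    intro n' h'
    generalize ha : code _ = a at h'
    cases h' <;> have := code_inj ha <;> simp_all
  | c2 i m =>
    intro n' h'
    generalize ha : code _ = a at h'
    cases h' <;> have := code_inj ha <;> simp_all
  | c4 p q r s m =>
    intro n' h'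
    generalize ha : code _ = a at h'
    generalize hm : p :: q :: r :: s :: m = m' at h'
    cases h' <;> have := code_inj ha <;> simp_all
  | c5 p q m =>
    intro n' h'
    generalize ha : code _ = a at h'
    generalize hm : p :: q :: m = m' at h'
    cases h' <;> have := code_inj ha <;> simp_all
  | comp b n m c q hq h1 h2 ih1 ih2 =>
    intro n' h'
    generalize ha : code _ = a at h'
    cases h' with
    | comp b' _ _ c' q' hq' h1' h2' =>
      have := code_inj ha
      simp only [List.cons_append, List.nil_append, List.cons.injEq, true_and] at this
      obtain ⟨rfl, rfl⟩ := this
      have : q = q' := by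
        apply List.ext_getElem (hq.trans hq'.symm)
        intro i hi hi'
        have := ih1 i (hq ▸ hi) _ (h1' i (hq ▸ hi))
        simpa [hi, hi'] using this
      subst this
      exact ih2 _ h2'
    | _ => have := code_inj ha; simp at this
  | univ b n m h ih =>
    intro n' h'
    generalize ha : code _ = a at h'
    generalize hm : b :: m = m' at h'
    cases h' with
    | univ b' _ m' h' =>
      simp only [List.cons.injEq] at hm
      obtain ⟨rfl, rfl⟩ := hm
      exact ih _ h'
    | _ => have := code_inj ha; simp at this
  | e0 b m f hf h ih =>
    intro n' h'
    generalize ha : code _ = a at h'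
    cases h' with
    | e0 => rfl
    | e1 b' p _ f' hf' h0' h' =>
      have := code_inj ha
      simp at this
      subst this
      have h1 := ih p _ h0'
      have h2 := hf p
      omega
    | _ => have := code_inj ha; simp at this
  | e1 b p m f hf h0 h ih0 ih =>
    intro n' h'
    generalize ha : code _ = a at h'
    cases h' with
    | e0 b' _ f' hf' h' =>
      have := code_inj ha
      simp at this
      subst this
      have h1 := ih0 _ (h' p)
      have h2 := hf' p
      omega
    | e1 b' p' _ f' hf' h0' h' =>
      have := code_inj ha
      simp at this
      subst this
      rcases lt_trichotomy p p' with hlt | rfl | hlt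
      · have h1 := ih0 _ (h' p hlt)
        have h2 := hf' p hlt
        omega
      · rfl
      · have h1 := ih p' hlt _ h0'
        have h2 := hf p' hlt
        omega
    | _ => have := code_inj ha; simp at this

/-- Lemma 4.2: `Comp` is deterministic, i.e. for all `a` and all tuples `m` there is
at most one `n` with `⟨a, m, n⟩ ∈ Comp`. -/
theorem comp_deterministic (Sb0 : ℕ → ℕ → ℕ) (a : ℕ) (m : List ℕ) (n n' : ℕ)
    (h : code (a :: m ++ [n]) ∈ Comp Sb0) (h' : code (a :: m ++ [n']) ∈ Comp Sb0) :
    n = n' :=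
  (CompD.of_code h).det n' (CompD.of_code h')
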